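/- Let (ε_t)_{t∈ℤ} be a bounded sequence in B and let (X_t)_{t∈ℤ} be a sequence in B with sup_{t∈ℤ} ‖X_t‖/(1 + |t|) < ∞ satisfying the autoregressive law of motion ∑_{j=0}^{∞} A_{0,j} X_{t−j} = ε_t for every t ∈ ℤ (the series converging in B). Then there exists τ₀ ∈ B such that for every t ≥ 1, X_t = τ₀ + Ψ_{−1} ∑_{s=1}^{t} ε_s + ∑_{j=0}^{∞} Φ_j ε_{t−j}, where the last series converges absolutely in B. -/

import Mathlib

open scoped Topology

/-- A power series that vanishes near `0` has vanishing coefficients. -/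
theorem eq_zero_of_eventually_hasSum_pow_smul_zero {E : Type*} [NormedAddCommGroup E]
    [NormedSpace ℂ E] {c : ℕ → E}
    (h : ∀ᶠ z in 𝓝 (0 : ℂ), HasSum (fun n : ℕ => z ^ n • c n) 0) (n : ℕ) : c n = 0 := by
  let p : FormalMultilinearSeries ℂ ℂ E :=
    fun n => ContinuousMultilinearMap.mkPiRing ℂ (Fin n) (c n)
  have hcoeff : ∀ n, p.coeff n = c n := fun n => by simp [FormalMultilinearSeries.coeff, p]
  have hp : HasFPowerSeriesAt (0 : ℂ → E) p 0 := by
    rw [hasFPowerSeriesAt_iff]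
    simpa only [hcoeff, Pi.zero_apply] using h
  rw [← hcoeff n, hp.eq_zero]
  simp [FormalMultilinearSeries.coeff]

/-- If two power series with coefficients in a Banach algebra converge absolutely near `0` and
the product of their sums is `1`, then the product of the formal power series is `1`. -/
theorem powerSeries_mul_eq_one {R : Type*} [NormedRing R] [NormedAlgebra ℂ R] [CompleteSpace R]
    {a b : ℕ → R}
    (ha : ∀ᶠ z in 𝓝 (0 : ℂ), Summable fun n : ℕ => ‖z ^ n • a n‖)
    (hb : ∀ᶠ z in 𝓝 (0 : ℂ), Summable fun n : ℕ => ‖z ^ n • b n‖)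
    (hab : ∀ᶠ z in 𝓝 (0 : ℂ), (∑' n : ℕ, z ^ n • a n) * (∑' n : ℕ, z ^ n • b n) = 1) :
    PowerSeries.mk a * PowerSeries.mk b = 1 := by
  refine sub_eq_zero.mp (PowerSeries.ext fun n => ?_)
  rw [map_zero]
  refine eq_zero_of_eventually_hasSum_pow_smul_zero
    (c := fun n => PowerSeries.coeff n (PowerSeries.mk a * PowerSeries.mk b - 1)) ?_ n
  filter_upwards [ha, hb, hab] with z hza hzb hzab
  have hsum := (summable_norm_sum_mul_antidiagonal_of_summable_norm hza hzb).of_norm.hasSum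
  rw [← tsum_mul_tsum_eq_tsum_sum_antidiagonal_of_summable_norm hza hzb, hzab] at hsum
  have hone : HasSum (fun n : ℕ => z ^ n • PowerSeries.coeff n (1 : PowerSeries R)) 1 := by
    convert hasSum_ite_eq (0 : ℕ) (1 : R) using 2 with n
    rw [PowerSeries.coeff_one]
    split_ifs with h <;> simp [h]
  convert hsum.sub hone using 2 with n
  · rw [map_sub, smul_sub, PowerSeries.coeff_mul, Finset.smul_sum]
    congr 1
    refine Finset.sum_congr rfl fun p hp => ?_
    rw [PowerSeries.coeff_mk, PowerSeries.coeff_mk, smul_mul_smul_comm, ← pow_add,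
      Finset.HasAntidiagonal.mem_antidiagonal.mp hp]
  · simp

/-- Iterated summation of an absolutely convergent double series along antidiagonals. -/
theorem tsum_tsum_eq_tsum_sum_antidiagonal {E : Type*} [NormedAddCommGroup E] [CompleteSpace E]
    {f : ℕ × ℕ → E} (hf : Summable f) :
    ∑' i, ∑' j, f (i, j) = ∑' n, ∑ p ∈ Finset.HasAntidiagonal.antidiagonal n, f p := by
  rw [← hf.tsum_prod, ← Finset.HasAntidiagonal.sigmaAntidiagonalEquivProd.tsum_eq f]
  refine (Finset.HasAntidiagonal.sigmaAntidiagonalEquivProd.summable_iff.mpr hf).tsum_sigma.trans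
    (tsum_congr fun n => ?_)
  rw [tsum_fintype]
  exact Finset.sum_coe_sort (Finset.HasAntidiagonal.antidiagonal n) f

theorem one_add_abs_sub_sub_le (t : ℤ) (i j : ℕ) :
    1 + |((t - i - j : ℤ) : ℝ)| ≤ (1 + |(t : ℝ)|) * ((1 + i) * (1 + j)) := by
  have h : |((t - i - j : ℤ) : ℝ)| ≤ |(t : ℝ)| + i + j := by
    push_cast
    refine (abs_sub _ _).trans ?_
    rw [Nat.abs_cast]
    gcongr
    refine (abs_sub _ _).trans ?_
    rw [Nat.abs_cast]
  have : 0 ≤ |(t : ℝ)| * (i + j + i * j) + i * j := by positivity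
  linarith

/-- Composing two causal linear filters whose coefficients have a summable first moment, applied
to a sequence of at most linear growth, amounts to applying the filter with convolved
coefficients. -/
theorem tsum_apply_eq_tsum_coeff_mul_apply {B : Type*} [NormedAddCommGroup B] [NormedSpace ℂ B]
    [CompleteSpace B] {a b : ℕ → (B →L[ℂ] B)}
    (ha : Summable fun n : ℕ => ‖a n‖ * (1 + n)) (hb : Summable fun n : ℕ => ‖b n‖ * (1 + n))
    {X ε : ℤ → B} (hX : ∃ M : ℝ, ∀ t : ℤ, ‖X t‖ ≤ M * (1 + |(t : ℝ)|))
    (hε : ∀ t : ℤ, HasSum (fun j : ℕ => b j (X (t - j))) (ε t)) (t : ℤ) :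
    ∑' i : ℕ, a i (ε (t - i)) =
      ∑' n : ℕ, PowerSeries.coeff n (PowerSeries.mk a * PowerSeries.mk b) (X (t - n)) := by
  obtain ⟨M, hM⟩ := hX
  have hM0 : 0 ≤ M := by simpa using (norm_nonneg _).trans (hM 0)
  have hf : Summable fun p : ℕ × ℕ => a p.1 (b p.2 (X (t - p.1 - p.2))) := by
    refine .of_norm_bounded (((ha.mul_of_nonneg hb (fun _ => by positivity)
      (fun _ => by positivity)).mul_left (M * (1 + |(t : ℝ)|)))) fun p => ?_
    calc ‖a p.1 (b p.2 (X (t - p.1 - p.2)))‖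
        ≤ ‖a p.1‖ * (‖b p.2‖ * ‖X (t - p.1 - p.2)‖) :=
          (a p.1).le_opNorm_of_le ((b p.2).le_opNorm _)
      _ ≤ ‖a p.1‖ * (‖b p.2‖ * (M * ((1 + |(t : ℝ)|) * ((1 + p.1) * (1 + p.2))))) := by
          gcongr
          exact (hM _).trans (by gcongr; exact one_add_abs_sub_sub_le t p.1 p.2)
      _ = _ := by ring
  calc ∑' i : ℕ, a i (ε (t - i)) = ∑' i : ℕ, ∑' j : ℕ, a i (b j (X (t - i - j))) :=
        tsum_congr fun i => ((a i).hasSum (hε (t - i))).tsum_eq.symm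
    _ = _ := by
        rw [tsum_tsum_eq_tsum_sum_antidiagonal hf]
        refine tsum_congr fun n => ?_
        rw [PowerSeries.coeff_mul, sum_apply]
        refine Finset.sum_congr rfl fun p hp => ?_
        rw [PowerSeries.coeff_mk, PowerSeries.coeff_mk, mul_apply_eq_comp,
          ← Finset.HasAntidiagonal.mem_antidiagonal.mp hp, Nat.cast_add, sub_sub]

theorem summable_mul_one_add_of_summable_mul_pow {u : ℕ → ℝ} (hu : ∀ n, 0 ≤ u n) {η : ℝ}
    (hη : 0 < η) (h : Summable fun n : ℕ => u n * (1 + η) ^ n) :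
    Summable fun n : ℕ => u n * (1 + n) := by
  refine .of_nonneg_of_le (fun n => mul_nonneg (hu n) (by positivity)) (fun n => ?_)
    (h.mul_left (1 + η⁻¹))
  have hpow : 1 + n * η ≤ (1 + η) ^ n := one_add_mul_le_pow (by linarith) n
  calc u n * (1 + n) ≤ u n * ((1 + η⁻¹) * (1 + n * η)) := by
        refine mul_le_mul_of_nonneg_left ?_ (hu n)
        have : (1 + η⁻¹) * (1 + n * η) = 1 + n + (n * η + η⁻¹) := by field_simp; ring
        have : 0 ≤ n * η + η⁻¹ := by positivity
        linarith
    _ ≤ u n * ((1 + η⁻¹) * (1 + η) ^ n) := by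
        refine mul_le_mul_of_nonneg_left ?_ (hu n)
        gcongr
    _ = _ := by ring

theorem summable_mul_one_add_of_le_geometric {u : ℕ → ℝ} (hu : ∀ n, 0 ≤ u n) {C r : ℝ}
    (hr0 : 0 ≤ r) (hr1 : r < 1) (h : ∀ n, u n ≤ C * r ^ n) :
    Summable fun n : ℕ => u n * (1 + n) := by
  have hr : ‖r‖ < 1 := by rwa [Real.norm_of_nonneg hr0]
  have hs := ((summable_geometric_of_norm_lt_one hr).add
    (by simpa using summable_pow_mul_geometric_of_norm_lt_one 1 hr)).mul_left C
  refine .of_nonneg_of_le (fun n => mul_nonneg (hu n) (by positivity)) (fun n => ?_) hs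
  calc u n * (1 + n) ≤ C * r ^ n * (1 + n) := by gcongr; exact h n
    _ = C * (r ^ n + n * r ^ n) := by ring

theorem eq_of_forall_eq_sub_one {E : Type*} {u : ℤ → E} (h : ∀ t : ℤ, 1 ≤ t → u t = u (t - 1))
    {t : ℤ} (ht : 0 ≤ t) : u t = u 0 := by
  induction t, ht using Int.leInduction with
  | base => rfl
  | succ t ht ih => rw [h (t + 1) (by lia), add_sub_cancel_right, ih]

/-- Let `A(z) = ∑_{j≥0} A_{0,j} z^j` with `∑_j ‖A_{0,j}‖(1 + η)^j < ∞`, invertible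
for `|z| ≤ 1 + η` except at `z = 1`, with a simple pole of `A(z)⁻¹` at `z = 1`:
`A(z)⁻¹ = Ψ_{−1}(1 − z)⁻¹ + g(z)`, `g` analytic on a disk of radius `> 1`, with exponentially
decaying Taylor coefficients `Φ_j` at `0`. Let `(ε_t)` be bounded, `(X_t)` of at most linear
growth, satisfying `∑_{j=0}^{∞} A_{0,j} X_{t−j} = ε_t` for every `t ∈ ℤ`. Then there exists
`τ₀ ∈ B` such that for every `t ≥ 1`,
`X_t = τ₀ + Ψ_{−1} ∑_{s=1}^{t} ε_s + ∑_{j=0}^{∞} Φ_j ε_{t−j}`, the last series converging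
absolutely in `B`. -/
theorem stmt19 {B : Type*} [NormedAddCommGroup B] [NormedSpace ℂ B] [CompleteSpace B]
    (η : ℝ) (hη : 0 < η)
    (A0 : ℕ → (B →L[ℂ] B)) (hA0 : Summable (fun j : ℕ => ‖A0 j‖ * (1 + η) ^ j))
    (A : ℂ → (B →L[ℂ] B)) (hAdef : ∀ z : ℂ, ‖z‖ ≤ 1 + η → HasSum (fun j : ℕ => z ^ j • A0 j) (A z))
    (hInv : ∀ z : ℂ, ‖z‖ ≤ 1 + η → z ≠ 1 → IsUnit (A z))
    (hNotInv : ¬ IsUnit (A 1))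
    (Ψm1 : B →L[ℂ] B) (g : ℂ → (B →L[ℂ] B)) (η' : ℝ) (hη' : 0 < η')
    (hg : AnalyticOnNhd ℂ g (Metric.ball (0 : ℂ) (1 + η')))
    (hpole : ∀ z : ℂ, ‖z‖ ≤ 1 + η → z ≠ 1 →
      Ring.inverse (A z) = ((1 - z)⁻¹) • Ψm1 + g z)
    (Φ : ℕ → (B →L[ℂ] B))
    (hΦ : ∀ᶠ z in 𝓝 (0 : ℂ), HasSum (fun j : ℕ => z ^ j • Φ j) (g z))
    (hΦdecay : ∃ C > (0 : ℝ), ∃ r : ℝ, r < 1 ∧ 0 ≤ r ∧ ∀ j : ℕ, ‖Φ j‖ ≤ C * r ^ j)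
    (ε : ℤ → B) (hε : ∃ M : ℝ, ∀ t : ℤ, ‖ε t‖ ≤ M)
    (X : ℤ → B) (hX : ∃ M : ℝ, ∀ t : ℤ, ‖X t‖ ≤ M * (1 + |(t : ℝ)|))
    (hAR : ∀ t : ℤ, HasSum (fun j : ℕ => (A0 j) (X (t - j))) (ε t)) :
    ∃ τ₀ : B, ∀ t : ℤ, 1 ≤ t →
      Summable (fun j : ℕ => ‖(Φ j) (ε (t - j))‖) ∧
      X t = τ₀ + Ψm1 (∑ s ∈ Finset.Icc (1 : ℤ) t, ε s) + ∑' j : ℕ, (Φ j) (ε (t - j)) := by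
  obtain ⟨C, hC, r, hr1, hr0, hΦb⟩ := hΦdecay
  obtain ⟨K, hK⟩ := hε
  have hΦ1 : Summable fun n : ℕ => ‖Φ n‖ * (1 + n) :=
    summable_mul_one_add_of_le_geometric (fun _ => norm_nonneg _) hr0 hr1 hΦb
  have hA1 : Summable fun n : ℕ => ‖A0 n‖ * (1 + n) :=
    summable_mul_one_add_of_summable_mul_pow (fun _ => norm_nonneg _) hη hA0
  have hΦs : Summable fun n : ℕ => ‖Φ n‖ :=
    .of_nonneg_of_le (fun _ => norm_nonneg _)
      (fun n => le_mul_of_one_le_right (norm_nonneg _) (by simp)) hΦ1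
  have hAs : Summable fun n : ℕ => ‖A0 n‖ :=
    .of_nonneg_of_le (fun _ => norm_nonneg _)
      (fun n => le_mul_of_one_le_right (norm_nonneg _) (by simp)) hA1
  have hΦε : ∀ t : ℤ, Summable fun j : ℕ => ‖Φ j (ε (t - j))‖ := fun t =>
    .of_nonneg_of_le (fun _ => norm_nonneg _)
      (fun j => (Φ j).le_opNorm_of_le (hK (t - j))) (hΦs.mul_right K)
  have hsmall : ∀ᶠ z in 𝓝 (0 : ℂ), ‖z‖ < 1 := by
    simpa [Metric.ball, Filter.Eventually] using Metric.ball_mem_nhds (0 : ℂ) one_pos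
  have hsmul : ∀ {c : ℕ → (B →L[ℂ] B)}, Summable (fun n => ‖c n‖) → ∀ {z : ℂ}, ‖z‖ < 1 →
      Summable fun n : ℕ => ‖z ^ n • c n‖ := fun hc z hz =>
    .of_nonneg_of_le (fun _ => norm_nonneg _) (fun n => by
      rw [norm_smul, norm_pow]
      exact mul_le_of_le_one_left (norm_nonneg _) (pow_le_one₀ (norm_nonneg _) hz.le)) hc
  have hgeom : ∀ {z : ℂ}, ‖z‖ < 1 → Summable fun n : ℕ => ‖z ^ n • Ψm1‖ := fun {z} hz => by
    simpa only [norm_smul, norm_pow] using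
      (summable_geometric_of_lt_one (norm_nonneg z) hz).mul_right ‖Ψm1‖
  have hinv : PowerSeries.mk (fun n => Ψm1 + Φ n) * PowerSeries.mk A0 = 1 := by
    refine powerSeries_mul_eq_one ?_ (hsmall.mono fun z hz => hsmul hAs hz) ?_
    · filter_upwards [hsmall] with z hz
      refine .of_nonneg_of_le (fun _ => norm_nonneg _) (fun n => ?_) ((hgeom hz).add (hsmul hΦs hz))
      rw [smul_add]
      exact norm_add_le _ _
    · filter_upwards [hsmall, hΦ] with z hz hzΦ
      have hz1 : z ≠ 1 := by rintro rfl; simp at hz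
      have hzη : ‖z‖ ≤ 1 + η := by linarith
      have hG : HasSum (fun n : ℕ => z ^ n • (Ψm1 + Φ n)) (Ring.inverse (A z)) := by
        rw [hpole z hzη hz1]
        simpa only [smul_add] using
          ((hasSum_geometric_of_norm_lt_one hz).smul_const Ψm1).add hzΦ
      rw [hG.tsum_eq, (hAdef z hzη).tsum_eq]
      exact Ring.inverse_mul_cancel _ (hInv z hzη hz1)
  let G : PowerSeries (B →L[ℂ] B) := PowerSeries.mk fun n => Ψm1 + Φ n
  let H : ℕ → (B →L[ℂ] B) := fun n => PowerSeries.coeff n ((1 - PowerSeries.X) * G)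
  have hHmk : PowerSeries.mk H = (1 - PowerSeries.X) * G :=
    PowerSeries.ext fun n => PowerSeries.coeff_mk n H
  have hHA : PowerSeries.mk H * PowerSeries.mk A0 = 1 - PowerSeries.X := by
    rw [hHmk, mul_assoc, hinv, mul_one]
  have hH0 : H 0 = Ψm1 + Φ 0 := by
    simp [H, G, sub_mul]
  have hHsucc : ∀ n, H (n + 1) = Φ (n + 1) - Φ n := fun n => by
    simp [H, G, sub_mul, PowerSeries.coeff_succ_X_mul]
  have hH1 : Summable fun n : ℕ => ‖H n‖ * (1 + n) := by
    refine (summable_nat_add_iff 1).mp (.of_nonneg_of_le (fun n => by positivity) (fun n => ?_)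
      (((summable_nat_add_iff 1).mpr hΦ1).add (hΦ1.mul_left 2)))
    have h1 : ‖H (n + 1)‖ ≤ ‖Φ (n + 1)‖ + ‖Φ n‖ := hHsucc n ▸ norm_sub_le _ _
    have h2 : (1 + (n + 1 : ℕ) : ℝ) ≤ 2 * (1 + n) := by
      push_cast
      linarith [n.cast_nonneg (α := ℝ)]
    calc ‖H (n + 1)‖ * (1 + (n + 1 : ℕ))
        ≤ (‖Φ (n + 1)‖ + ‖Φ n‖) * (1 + (n + 1 : ℕ)) := by gcongr
      _ ≤ ‖Φ (n + 1)‖ * (1 + (n + 1 : ℕ)) + ‖Φ n‖ * (2 * (1 + n)) := by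
          rw [add_mul]
          gcongr
      _ = _ := by ring
  have hstep : ∀ t : ℤ, X t - X (t - 1) =
      Ψm1 (ε t) + ∑' j : ℕ, Φ j (ε (t - j)) - ∑' j : ℕ, Φ j (ε (t - 1 - j)) := by
    intro t
    have hXdiff : HasSum (fun n : ℕ =>
        PowerSeries.coeff n (1 - PowerSeries.X : PowerSeries (B →L[ℂ] B)) (X (t - n)))
        (X t - X (t - 1)) := by
      convert (hasSum_ite_eq (0 : ℕ) (X t)).sub (hasSum_ite_eq (1 : ℕ) (X (t - 1))) using 2 with n
      rw [map_sub, PowerSeries.coeff_one, PowerSeries.coeff_X]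
      split_ifs with h h' h' <;> simp_all
    have hHε : HasSum (fun n : ℕ => H n (ε (t - n)))
        (Ψm1 (ε t) + ∑' j : ℕ, Φ j (ε (t - j)) - ∑' j : ℕ, Φ j (ε (t - 1 - j))) := by
      have hu := (hΦε t).of_norm.hasSum
      have hv := (hΦε (t - 1)).of_norm.hasSum
      rw [← hasSum_nat_add_iff' 1] at hu
      rw [← hasSum_nat_add_iff' 1, Finset.sum_range_one]
      rw [Finset.sum_range_one] at hu
      convert hu.sub hv using 1
      · funext n
        rw [hHsucc, sub_apply, Nat.cast_succ, add_comm (n : ℤ) 1, sub_sub]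
      · rw [hH0, add_apply, Nat.cast_zero, sub_zero]
        abel
    rw [← hXdiff.tsum_eq, ← hHA, ← tsum_apply_eq_tsum_coeff_mul_apply hH1 hA1 hX hAR t,
      hHε.tsum_eq]
  refine ⟨X 0 - ∑' j : ℕ, Φ j (ε (0 - j)), fun t ht => ⟨hΦε t, ?_⟩⟩
  have hconst := eq_of_forall_eq_sub_one (u := fun t : ℤ =>
    X t - ∑' j : ℕ, Φ j (ε (t - j)) - Ψm1 (∑ s ∈ Finset.Icc (1 : ℤ) t, ε s))
    (fun t ht => by
      have hIcc : ∑ s ∈ Finset.Icc (1 : ℤ) t, ε s =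
          ε t + ∑ s ∈ Finset.Icc (1 : ℤ) (t - 1), ε s := by
        rw [← Finset.insert_Icc_sub_one_right_eq_Icc ht, Finset.sum_insert (by simp)]
      have hX' := eq_add_of_sub_eq (hstep t)
      simp only [hIcc, map_add, hX']
      abel) (zero_le_one.trans ht)
  simp only [Finset.Icc_eq_empty_of_lt zero_lt_one, Finset.sum_empty, map_zero, sub_zero]
    at hconst
  rw [← hconst]
  abel
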